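/- Let j ≥ 4 and let H = (h_0, …, h_j) be a symmetric sequence (h_i = h_{j−i}) of positive integers with h_0 = 1, h_1 = 4, and h_2 = a ≤ 6. Then H is a Gorenstein sequence (the Hilbert function of some graded Artinian Gorenstein quotient of K[w,x,y,z]) if and only if ΔH_{≤ j/2} is an O-sequence. Moreover, the values a = 2 and a = 3 cannot occur: no Gorenstein sequence of socle degree j ≥ 4 has h_1 = 4 and h_2 ∈ {2, 3}. -/

import Mathlib

open MvPolynomial

noncomputable section

/-- The Hilbert function of the graded quotient `R/I`, where
`R = K[x_1,...,x_n]`: the dimension of the image in `R/I` of the space of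
degree-`i` homogeneous forms. -/
def hilb (n : ℕ) (K : Type*) [Field K] (I : Ideal (MvPolynomial (Fin n) K)) (i : ℕ) : ℕ :=
  Module.finrank K
    ((homogeneousSubmodule (Fin n) K i).map (Ideal.Quotient.mkₐ K I).toLinearMap)

/-- The socle `(0 : A_+)` of `A = R/I`: the elements killed by (the images of)
all the variables, equivalently by the irrelevant maximal ideal. -/
def socleSub (n : ℕ) (K : Type*) [Field K] (I : Ideal (MvPolynomial (Fin n) K)) :
    Submodule K (MvPolynomial (Fin n) K ⧸ I) :=
  ⨅ k : Fin n, LinearMap.ker (LinearMap.mulLeft K (Ideal.Quotient.mk I (X k)))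

/-- A homogeneous (graded) ideal: one containing each homogeneous component of
each of its elements. -/
def IdealHomog {n : ℕ} {K : Type*} [Field K] (I : Ideal (MvPolynomial (Fin n) K)) : Prop :=
  ∀ f ∈ I, ∀ d : ℕ, homogeneousComponent d f ∈ I

/-- `R/I` is a graded Artinian Gorenstein quotient of `R = K[x_1,...,x_n]`
of socle degree `j`: `I` is homogeneous, `R/I` is finite dimensional over `K`
with 1-dimensional socle, and `j` is the top nonzero degree. -/
def IsAG (n : ℕ) (K : Type*) [Field K] (I : Ideal (MvPolynomial (Fin n) K)) (j : ℕ) : Prop :=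
  IdealHomog I ∧ FiniteDimensional K (MvPolynomial (Fin n) K ⧸ I) ∧
    Module.finrank K (socleSub n K I) = 1 ∧
    hilb n K I j ≠ 0 ∧ ∀ i, j < i → hilb n K I i = 0

/-- Macaulay's bound `c^{(d)}`: writing `c = C(k_d,d) + ... + C(k_1,1)` with
`k_d > k_d-1 > ... > k_1 ≥ 0` (the `d`-th Macaulay expansion, computed greedily),
`c^{(d)} = C(k_d+1,d+1) + ... + C(k_1+1,2)`; by convention `0^{(d)} = 0`. -/
def macB : ℕ → ℕ → ℕ
  | _, 0 => 0
  | c, (d+1) =>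
    if c = 0 then 0 else
      let k := Nat.findGreatest (fun k => Nat.choose k (d+1) ≤ c) (c + d + 1)
      Nat.choose (k+1) (d+2) + macB (c - Nat.choose k (d+1)) d

/-- `(t_0, ..., t_m)` is an O-sequence: `t_0 = 1` and `t_{i+1} ≤ t_i^{(i)}`
for `1 ≤ i ≤ m-1`. -/
def IsOSeq (t : ℕ → ℕ) (m : ℕ) : Prop :=
  t 0 = 1 ∧ ∀ i, 1 ≤ i → i + 1 ≤ m → t (i + 1) ≤ macB (t i) i

/-- `ΔH_{≤ m}` is an O-sequence: the first differences `ΔH_i = h_i - h_{i-1}`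
(with `ΔH_0 = 1`) are nonnegative for `i ≤ m`, and `(ΔH_0, ..., ΔH_m)` is an
O-sequence. -/
def DeltaOSeq (h : ℕ → ℕ) (m : ℕ) : Prop :=
  (∀ i, 1 ≤ i → i ≤ m → h (i - 1) ≤ h i) ∧
    IsOSeq (fun i => if i = 0 then 1 else h i - h (i - 1)) m


section core
open Filter Module

variable {K : Type*} [Field K] [CharZero K] {E U : Type*} [AddCommGroup E] [Module K E]
  [AddCommGroup U] [Module K U] 

theorem li_cofinite {ι : Type*} [Fintype ι] [DecidableEq ι] (x y : ι → U) (hx : LinearIndependent K x) :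
    ∀ᶠ t : K in cofinite, LinearIndependent K (fun i => x i + t • y i) := by
  obtain ⟨f, hf⟩ := LinearMap.exists_leftInverse_of_injective (Fintype.linearCombination K x)
    (LinearMap.ker_eq_bot.2 (by
      exact hx.fintypeLinearCombination_injective))
  have hfx : ∀ i, f (x i) = Pi.single i 1 := by
    intro i
    have := LinearMap.congr_fun hf (Pi.single i 1)
    simpa [Fintype.linearCombination_apply_single] using this
  let Y : Matrix ι ι K := fun i j => f (y i) j
  let P : Polynomial K := (1 + (Polynomial.X : Polynomial K) • Y.map Polynomial.C).det
  have hP : ∀ t, P.eval t = (1 + t • Y).det := by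
    intro t
    have := RingHom.map_det (Polynomial.evalRingHom t)
      (1 + (Polynomial.X : Polynomial K) • Y.map Polynomial.C)
    rw [show P.eval t = _ from this]
    congr 1
    ext i j
    by_cases hij : i = j <;> simp [hij] <;> ring
  have hP0 : P ≠ 0 := by
    intro h
    have := hP 0
    simp [h] at this
  have hfin : {t : K | P.eval t = 0}.Finite := by
    exact Polynomial.finite_setOfPred_isRoot hP0
  have : ∀ᶠ t : K in cofinite, P.eval t ≠ 0 := by
    rw [eventually_cofinite]; simpa using hfin
  filter_upwards [this] with t ht
  rw [hP] at ht
  have h1 := Matrix.linearIndependent_rows_of_det_ne_zero ht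
  refine LinearIndependent.of_comp f ?_
  have h2 : (⇑f ∘ fun i => x i + t • y i) = fun i => (1 + t • Y) i := by
    ext i j
    rw [Matrix.add_apply, Matrix.smul_apply]
    simp [hfx, Y, Matrix.one_apply, Pi.single_apply, eq_comm]
  rw [h2]
  exact h1

theorem exists_li_range [FiniteDimensional K U] (M : E →ₗ[K] U) :
    ∃ e : Fin (finrank K (LinearMap.range M)) → E, LinearIndependent K (fun i => M (e i)) ∧
      Submodule.span K (Set.range fun i => M (e i)) = LinearMap.range M := by
  let b := Module.finBasis K (LinearMap.range M)
  choose e he using fun i => (b i).2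
  refine ⟨e, ?_, ?_⟩
  · simp only [he]
    exact b.linearIndependent.map' (LinearMap.range M).subtype (by simp)
  · simp only [he]
    have := b.span_eq
    apply_fun Submodule.map (LinearMap.range M).subtype at this
    rw [Submodule.map_span, ← Set.range_comp] at this
    simpa [Function.comp_def] using this

theorem le_rank_of_li [FiniteDimensional K U] {ι : Type*} [Fintype ι] (M : E →ₗ[K] U) (x : ι → U)
    (hx : LinearIndependent K x) (h : ∀ i, x i ∈ LinearMap.range M) :
    Fintype.card ι ≤ finrank K (LinearMap.range M) := by
  rw [← finrank_span_eq_card hx]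
  exact Submodule.finrank_mono (Submodule.span_le.2 (by rintro _ ⟨i, rfl⟩; exact h i))

theorem rank_cofinite [FiniteDimensional K U] (M N : E →ₗ[K] U) :
    ∀ᶠ t : K in cofinite, finrank K (LinearMap.range M) ≤ finrank K (LinearMap.range (M + t • N)) := by
  obtain ⟨e, he, -⟩ := exists_li_range M
  filter_upwards [li_cofinite _ (fun i => N (e i)) he] with t ht
  have := le_rank_of_li (M + t • N) _ ht (fun i => ⟨e i, by simp⟩)
  simpa using this

theorem ker_deform [FiniteDimensional K U] (M N : E →ₗ[K] U)
    (hmax : ∀ t : K, finrank K (LinearMap.range (M + t • N)) ≤ finrank K (LinearMap.range M))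
    (k : E) (hk : M k = 0) : N k ∈ LinearMap.range M := by
  by_contra hn
  obtain ⟨e, he, hs⟩ := exists_li_range M
  have h1 : LinearIndependent K (fun o : Option (Fin (finrank K (LinearMap.range M))) =>
      o.elim (N k) (fun i => M (e i))) := by
    rw [linearIndependent_option]
    refine ⟨he, ?_⟩
    have : ((fun o : Option (Fin (finrank K (LinearMap.range M))) =>
      o.elim (N k) (fun i => M (e i))) ∘ some) = fun i => M (e i) := rfl
    rw [this, hs]
    exact hn
  have h2 := li_cofinite _ (fun o : Option (Fin (finrank K (LinearMap.range M))) =>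
      o.elim 0 (fun i => N (e i))) h1
  have h3 : ∀ᶠ t : K in cofinite, t ≠ 0 := by
    rw [eventually_cofinite]; simp
  obtain ⟨t, ht, ht0⟩ := (h2.and h3).exists
  have := le_rank_of_li (M + t • N) _ ht (by
    rintro (_ | i)
    · exact ⟨t⁻¹ • k, by simp [hk, ht0]⟩
    · exact ⟨e i, by simp⟩)
  have h4 := hmax t
  simp at this
  omega

/-- nonvanishing is a cofinite condition on lines -/
theorem ne_cofinite_lin (x y : U) (hx : x ≠ 0) : ∀ᶠ t : K in cofinite, x + t • y ≠ 0 := by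
  have := li_cofinite (K := K) (fun _ : Unit => x) (fun _ => y) (by simpa using hx)
  filter_upwards [this] with t ht
  simpa using ht

theorem ne_cofinite_quad (x y z : U) (hxz : x ≠ 0 ∨ z ≠ 0) :
    ∀ᶠ t : K in cofinite, x + t • y + (t * t) • z ≠ 0 := by
  obtain ⟨f, hf⟩ : ∃ f : Module.Dual K U, f x ≠ 0 ∨ f z ≠ 0 := by
    by_contra! h
    rcases hxz with hx | hz
    · exact hx ((Module.forall_dual_apply_eq_zero_iff K x).1 fun f => (h f).1)
    · exact hz ((Module.forall_dual_apply_eq_zero_iff K z).1 fun f => (h f).2)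
  let P : Polynomial K := Polynomial.C (f x) + Polynomial.C (f y) * Polynomial.X +
    Polynomial.C (f z) * Polynomial.X ^ 2
  have hP0 : P ≠ 0 := by
    intro h
    have h2 := congrArg (fun p => Polynomial.coeff p 2) h
    have h0 := congrArg (fun p => Polynomial.coeff p 0) h
    simp [P, Polynomial.coeff_X, Polynomial.coeff_C] at h2 h0
    tauto
  have h1 : ∀ᶠ t : K in cofinite, ¬ P.IsRoot t := by
    rw [eventually_cofinite]; simpa using Polynomial.finite_setOfPred_isRoot hP0
  filter_upwards [h1] with t ht h0
  apply ht
  have := congrArg f h0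
  simp only [map_add, map_smul, smul_eq_mul, map_zero] at this
  simp only [P, Polynomial.IsRoot, Polynomial.eval_add, Polynomial.eval_mul, Polynomial.eval_C,
    Polynomial.eval_X, Polynomial.eval_pow]
  linear_combination this

theorem exists_good [FiniteDimensional K U] [Nontrivial U] (μ : E →ₗ[K] E →ₗ[K] U)
    (hsymm : ∀ x y, μ x y = μ y x)
    (hspan : ∀ S : Submodule K U, (∀ x y, μ x y ∈ S) → S = ⊤) :
    ∃ l, μ l l ≠ 0 ∧ ∀ l', finrank K (LinearMap.range (μ l')) ≤ finrank K (LinearMap.range (μ l)) := by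
  have h1 : ∃ l0, μ l0 l0 ≠ 0 := by
    by_contra! h
    have := hspan ⊥ (by
      intro x y
      have h2 := h (x + y)
      simp only [map_add, LinearMap.add_apply, h, hsymm y x, zero_add, add_zero, ← two_smul K] at h2
      simpa using h2)
    exact bot_ne_top this
  obtain ⟨l0, hl0⟩ := h1
  obtain ⟨l1, hl1⟩ : ∃ l1, ∀ l', finrank K (LinearMap.range (μ l')) ≤ finrank K (LinearMap.range (μ l1)) := by
    have hb : BddAbove (Set.range fun l => finrank K (LinearMap.range (μ l))) :=
      ⟨finrank K U, by rintro _ ⟨l, rfl⟩; exact Submodule.finrank_le _⟩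
    obtain ⟨l1, h⟩ := Nat.sSup_mem (Set.range_nonempty _) hb
    refine ⟨l1, fun l' => ?_⟩
    simp only at h
    rw [h]
    exact le_csSup hb ⟨l', rfl⟩
  obtain ⟨t, ht1, ht2⟩ := ((rank_cofinite (μ l1) (μ l0)).and
    (ne_cofinite_quad (μ l1 l1) ((2 : K) • μ l1 l0) (μ l0 l0) (Or.inr hl0))).exists
  refine ⟨l1 + t • l0, ?_, fun l' => (hl1 l').trans (by rw [map_add, map_smul]; exact ht1)⟩
  convert ht2 using 1
  simp [hsymm l0 l1]
  module


theorem core_two [FiniteDimensional K U] (μ : E →ₗ[K] E →ₗ[K] U)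
    (hsymm : ∀ x y, μ x y = μ y x)
    (hspan : ∀ S : Submodule K U, (∀ x y, μ x y ∈ S) → S = ⊤) (hU : finrank K U ≤ 2) :
    ∃ l, LinearMap.range (μ l) = ⊤ := by
  rcases subsingleton_or_nontrivial U with hs | hs
  · exact ⟨0, Subsingleton.elim _ _⟩
  obtain ⟨l, hl, hmax⟩ := exists_good μ hsymm hspan
  refine ⟨l, ?_⟩
  have hker : ∀ k, μ l k = 0 → ∀ u, μ u k ∈ LinearMap.range (μ l) := fun k hk u =>
    ker_deform (μ l) (μ u) (fun t => by
      rw [← map_smul, ← map_add]; exact hmax _) k hk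
  by_cases h2 : 2 ≤ finrank K (LinearMap.range (μ l))
  · exact Submodule.eq_top_of_finrank_eq (le_antisymm (Submodule.finrank_le _) (hU.trans h2))
  have hsp : Submodule.span K {μ l l} = LinearMap.range (μ l) := by
    apply Submodule.eq_of_le_of_finrank_le
    · rw [Submodule.span_singleton_le_iff_mem]; exact ⟨l, rfl⟩
    · rw [finrank_span_singleton hl]; omega
  apply hspan
  intro x y
  have hy : μ l y ∈ Submodule.span K {μ l l} := by rw [hsp]; exact ⟨y, rfl⟩
  obtain ⟨c, hc⟩ := Submodule.mem_span_singleton.1 hy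
  have h3 := hker (y - c • l) (by simp [hc]) x
  have h4 : μ x y = μ x (y - c • l) + c • μ l x := by simp [hsymm x l]
  rw [h4]
  exact add_mem h3 (Submodule.smul_mem _ _ ⟨x, rfl⟩)

theorem core_pair [FiniteDimensional K U] [FiniteDimensional K E] (μ : E →ₗ[K] E →ₗ[K] U)
    (hsymm : ∀ x y, μ x y = μ y x)
    (hspan : ∀ S : Submodule K U, (∀ x y, μ x y ∈ S) → S = ⊤)
    (hE : finrank K E = 4) (hU : finrank K U ≤ 6)
    (hbad : ∀ l l', LinearMap.range (μ l) ⊔ LinearMap.range (μ l') ≠ ⊤)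
    (l : E) (hl : μ l l ≠ 0)
    (hmax : ∀ l', finrank K (LinearMap.range (μ l')) ≤ finrank K (LinearMap.range (μ l))) :
    ∃ k, k ≠ 0 ∧ μ l k = 0 ∧
      ∀ x y, μ x y = 0 → x ∈ Submodule.span K {l, k} ∨ y ∈ Submodule.span K {l, k} := by
  have hker : ∀ k, μ l k = 0 → ∀ u, μ u k ∈ LinearMap.range (μ l) := fun k hk u =>
    ker_deform (μ l) (μ u) (fun t => by
      rw [← map_smul, ← map_add]; exact hmax _) k hk
  set R := LinearMap.range (μ l) with hR
  let ν : E →ₗ[K] E →ₗ[K] (U ⧸ R) := μ.compr₂ R.mkQ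
  have hν : ∀ x y, ν x y = R.mkQ (μ x y) := fun x y => rfl
  have hνsymm : ∀ x y, ν x y = ν y x := fun x y => by rw [hν, hν, hsymm]
  have hνspan : ∀ S : Submodule K (U ⧸ R), (∀ x y, ν x y ∈ S) → S = ⊤ := by
    intro S hS
    have := hspan (S.comap R.mkQ) (fun x y => hS x y)
    rw [eq_top_iff]
    intro z _
    obtain ⟨z, rfl⟩ := R.mkQ_surjective z
    have h2 : z ∈ S.comap R.mkQ := by rw [this]; trivial
    exact h2
  have hQ3 : 3 ≤ finrank K (U ⧸ R) := by
    by_contra hlt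
    obtain ⟨l', hl'⟩ := core_two ν hνsymm hνspan (by omega)
    apply hbad l l'
    rw [eq_top_iff]
    intro z _
    have : R.mkQ z ∈ LinearMap.range (ν l') := by rw [hl']; trivial
    obtain ⟨w, hw⟩ := this
    rw [hν, ← sub_eq_zero, ← map_sub] at hw
    have hw2 : μ l' w - z ∈ R := (Submodule.Quotient.mk_eq_zero R).1 hw
    have : z = -(μ l' w - z) + μ l' w := by abel
    rw [this]
    exact Submodule.add_mem_sup (neg_mem hw2) ⟨w, rfl⟩
  have hdim := R.finrank_quotient_add_finrank
  have hrn := LinearMap.finrank_range_add_finrank_ker (μ l)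
  have hkpos : 0 < finrank K (LinearMap.ker (μ l)) := by rw [← hR] at hrn; omega
  have : Nontrivial (LinearMap.ker (μ l)) := finrank_pos_iff.1 hkpos
  obtain ⟨⟨k, hk⟩, hk0⟩ := exists_ne (0 : LinearMap.ker (μ l))
  have hk0 : k ≠ 0 := fun h => hk0 (by simpa using h)
  rw [LinearMap.mem_ker] at hk
  refine ⟨k, hk0, hk, ?_⟩
  set S := Submodule.span K {l, k} with hS
  have hli : LinearIndependent K ![l, k] := by
    rw [LinearIndependent.pair_iff]
    intro s t hst
    have h1 := congrArg (μ l) hst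
    simp only [map_add, map_smul, hk, smul_zero, add_zero, map_zero, smul_eq_zero, hl, or_false] at h1
    subst h1
    simpa [hk0] using hst
  have hSdim : finrank K S = 2 := by
    have := finrank_span_eq_card hli
    rw [Matrix.range_cons, Matrix.range_cons, Matrix.range_empty, Set.union_empty,
      Set.singleton_union] at this
    simpa [hS] using this
  have hSq := S.finrank_quotient_add_finrank
  let b := Module.finBasisOfFinrankEq K (E ⧸ S) (show finrank K (E ⧸ S) = 2 by omega)
  obtain ⟨e, he⟩ := S.mkQ_surjective (b 0)
  obtain ⟨f, hf⟩ := S.mkQ_surjective (b 1)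
  have hdec : ∀ x, ∃ γ δ : K, x - γ • e - δ • f ∈ S := by
    intro x
    refine ⟨b.repr (S.mkQ x) 0, b.repr (S.mkQ x) 1, ?_⟩
    rw [← Submodule.Quotient.mk_eq_zero, ← Submodule.mkQ_apply, map_sub, map_sub, map_smul, map_smul,
      he, hf, sub_sub, sub_eq_zero]
    have := b.sum_repr (S.mkQ x)
    rw [Fin.sum_univ_two] at this
    exact this.symm
  have hν0 : ∀ z ∈ S, ∀ y, ν z y = 0 := by
    intro z hz y
    obtain ⟨α, β, rfl⟩ := Submodule.mem_span_pair.1 hz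
    have h1 : ν l y = 0 := by
      rw [hν]; simp only [Submodule.mkQ_apply, Submodule.Quotient.mk_eq_zero]; exact ⟨y, rfl⟩
    have h2 : ν k y = 0 := by
      rw [hν, hsymm]; simp only [Submodule.mkQ_apply, Submodule.Quotient.mk_eq_zero]; exact hker k hk y
    simp [h1, h2]
  have hprod : ∀ x y : E, ∀ γ δ γ' δ' : K, x - γ • e - δ • f ∈ S → y - γ' • e - δ' • f ∈ S →
      ν x y = (γ * γ') • ν e e + (γ * δ' + δ * γ') • ν e f + (δ * δ') • ν f f := by
    intro x y γ δ γ' δ' hx hy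
    have h1 : ν x y = ν (γ • e + δ • f) y := by
      rw [← sub_eq_zero, ← LinearMap.sub_apply, ← map_sub, ← sub_sub]; exact hν0 _ hx y
    have h2 : ν (γ • e + δ • f) y = ν (γ • e + δ • f) (γ' • e + δ' • f) := by
      rw [← sub_eq_zero, ← map_sub, hνsymm, ← sub_sub]; exact hν0 _ hy _
    rw [h1, h2]
    simp only [map_add, map_smul, LinearMap.add_apply, LinearMap.smul_apply, hνsymm f e]
    module
  have hsp3 : Submodule.span K (Set.range ![ν e e, ν e f, ν f f]) = ⊤ := by
    apply hνspan
    intro x y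
    obtain ⟨γ, δ, hx⟩ := hdec x
    obtain ⟨γ', δ', hy⟩ := hdec y
    rw [hprod x y γ δ γ' δ' hx hy]
    refine add_mem (add_mem ?_ ?_) ?_ <;> apply Submodule.smul_mem <;> apply Submodule.subset_span
    · exact ⟨0, rfl⟩
    · exact ⟨1, rfl⟩
    · exact ⟨2, rfl⟩
  have hQ3' : finrank K (U ⧸ R) ≤ 3 := by
    have := finrank_range_le_card (R := K) ![ν e e, ν e f, ν f f]
    rw [Set.finrank, hsp3, finrank_top] at this
    simpa using this
  have hli3 : LinearIndependent K ![ν e e, ν e f, ν f f] :=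
    linearIndependent_of_top_le_span_of_card_eq_finrank hsp3.ge (by simp; omega)
  intro x y hxy
  obtain ⟨γ, δ, hx⟩ := hdec x
  obtain ⟨γ', δ', hy⟩ := hdec y
  have h1 := hprod x y γ δ γ' δ' hx hy
  rw [hν, hxy, map_zero] at h1
  rw [Fintype.linearIndependent_iff] at hli3
  have h2 := hli3 ![γ * γ', γ * δ' + δ * γ', δ * δ'] (by simpa [Fin.sum_univ_three] using h1.symm)
  have ha := h2 0
  have hb := h2 1
  have hc := h2 2
  simp at ha hb hc
  by_cases hγ : γ = 0
  · by_cases hδ : δ = 0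
    · left; simpa [hγ, hδ] using hx
    · right
      have hd' : δ' = 0 := by tauto
      have hg' : γ' = 0 := by
        rw [hγ] at hb; simp at hb; tauto
      simpa [hd', hg'] using hy
  · right
    have hg' : γ' = 0 := by tauto
    have hd' : δ' = 0 := by
      rw [hg'] at hb; simp at hb; tauto
    simpa [hd', hg'] using hy

theorem core [FiniteDimensional K U] [FiniteDimensional K E] (μ : E →ₗ[K] E →ₗ[K] U)
    (hsymm : ∀ x y, μ x y = μ y x)
    (hspan : ∀ S : Submodule K U, (∀ x y, μ x y ∈ S) → S = ⊤)
    (hE : finrank K E = 4) (hU : finrank K U ≤ 6)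
    (hns : ∀ k, (∀ x, μ k x = 0) → k = 0) :
    ∃ l l', LinearMap.range (μ l) ⊔ LinearMap.range (μ l') = ⊤ := by
  by_contra! hbad
  rcases subsingleton_or_nontrivial U with hs | hs
  · exact hbad 0 0 (Subsingleton.elim _ _)
  obtain ⟨l, hl, hmax⟩ := exists_good μ hsymm hspan
  obtain ⟨k, hk0, hlk, hP⟩ := core_pair μ hsymm hspan hE hU hbad l hl hmax
  set S := Submodule.span K {l, k} with hS
  have hlS : l ∈ S := Submodule.subset_span (by simp)
  have hout : ∀ u, u ∉ S → μ k u = 0 := by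
    intro u hu
    have hne : ∀ᶠ t : K in cofinite, t ≠ 0 := by
      rw [eventually_cofinite]; simp
    obtain ⟨t, ⟨⟨ht1, ht2⟩, ht3⟩, ht0⟩ := (((rank_cofinite (μ l) (μ u)).and
      (ne_cofinite_quad (μ l l) ((2 : K) • μ l u) (μ u u) (Or.inl hl))).and
      (ne_cofinite_lin (K := K) (μ l l) (μ u l) hl) |>.and hne).exists
    have hl2S : l + t • u ∉ S := by
      intro h
      apply hu
      have : t • u ∈ S := by simpa using sub_mem h hlS
      exact (Submodule.smul_mem_iff _ ht0).1 this
    obtain ⟨k2, hk20, hlk2, hP2⟩ := core_pair μ hsymm hspan hE hU hbad (l + t • u)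
      (by
        convert ht2 using 1
        simp [hsymm u l]
        module) (fun l' => (hmax l').trans (by rw [map_add, map_smul]; exact ht1))
    have hk2S : k2 ∈ S := (hP _ _ hlk2).resolve_left hl2S
    have hkey : ∀ z ∈ S, z ∈ Submodule.span K {l + t • u, k2} → μ (l + t • u) z = 0 := by
      intro z hz hz2
      obtain ⟨α, β, hz3⟩ := Submodule.mem_span_pair.1 hz2
      have hα : α = 0 := by
        by_contra hα
        apply hl2S
        rw [← Submodule.smul_mem_iff _ hα]
        have : α • (l + t • u) = z - β • k2 := by rw [← hz3]; abel
        rw [this]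
        exact sub_mem hz (Submodule.smul_mem _ _ hk2S)
      rw [← hz3, hα]
      simp only [zero_smul, zero_add, map_smul, hlk2, smul_zero]
    rcases hP2 l k hlk with h | h
    · exfalso
      apply ht3
      have := hkey l hlS h
      simpa using this
    · have := hkey k (Submodule.subset_span (by simp)) h
      simp only [map_add, map_smul, LinearMap.add_apply, LinearMap.smul_apply, hlk, zero_add,
        smul_eq_zero, ht0, false_or] at this
      rw [hsymm]; exact this
  apply hk0
  apply hns
  intro x
  by_cases hx : x ∈ S
  · obtain ⟨u, hu⟩ : ∃ u, u ∉ S := by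
      by_contra! h
      have h1 : S = ⊤ := eq_top_iff.2 fun z _ => h z
      have h2 : finrank K S ≤ 2 := by
        have h3 := finrank_range_le_card (R := K) ![l, k]
        rw [Set.finrank, Matrix.range_cons, Matrix.range_cons, Matrix.range_empty, Set.union_empty,
          Set.singleton_union] at h3
        simpa [hS] using h3
      rw [h1, finrank_top] at h2
      omega
    have h3 := hout (u + x) (fun h => hu (by simpa using sub_mem h hx))
    rw [map_add, hout u hu, zero_add] at h3
    exact h3
  · exact hout x hx

end core


section agstruct
open Module

variable {n : ℕ} {K : Type*} [Field K]

theorem q_smul_mul {I : Ideal (MvPolynomial (Fin n) K)} (c : K) (x y : MvPolynomial (Fin n) K ⧸ I) :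
    c • x * y = c • (x * y) := Algebra.smul_mul_assoc c x y

theorem q_mul_smul {I : Ideal (MvPolynomial (Fin n) K)} (c : K) (x y : MvPolynomial (Fin n) K ⧸ I) :
    x * c • y = c • (x * y) := Algebra.mul_smul_comm c x y

/-- graded piece of the quotient -/
def gr (I : Ideal (MvPolynomial (Fin n) K)) (i : ℕ) : Submodule K (MvPolynomial (Fin n) K ⧸ I) :=
  (homogeneousSubmodule (Fin n) K i).map (Ideal.Quotient.mkₐ K I).toLinearMap

theorem hilb_eq_gr (I : Ideal (MvPolynomial (Fin n) K)) (i : ℕ) :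
    hilb n K I i = finrank K (gr I i) := rfl

theorem mem_gr {I : Ideal (MvPolynomial (Fin n) K)} {i : ℕ} {x : MvPolynomial (Fin n) K ⧸ I} :
    x ∈ gr I i ↔ ∃ f : MvPolynomial (Fin n) K, f.IsHomogeneous i ∧ Ideal.Quotient.mk I f = x := by
  simp only [gr, Submodule.mem_map, mem_homogeneousSubmodule]
  rfl

theorem gr_mul {I : Ideal (MvPolynomial (Fin n) K)} {i k : ℕ} {x y : MvPolynomial (Fin n) K ⧸ I}
    (hx : x ∈ gr I i) (hy : y ∈ gr I k) : x * y ∈ gr I (i + k) := by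
  obtain ⟨f, hf, rfl⟩ := mem_gr.1 hx
  obtain ⟨g, hg, rfl⟩ := mem_gr.1 hy
  exact mem_gr.2 ⟨f * g, hf.mul hg, by simp⟩

theorem X_mem_gr (I : Ideal (MvPolynomial (Fin n) K)) (k : Fin n) :
    Ideal.Quotient.mk I (X k) ∈ gr I 1 := mem_gr.2 ⟨X k, isHomogeneous_X _ _, rfl⟩

theorem one_mem_gr (I : Ideal (MvPolynomial (Fin n) K)) : 1 ∈ gr I 0 :=
  mem_gr.2 ⟨1, isHomogeneous_one _ _, by simp⟩

theorem gr_succ_le (I : Ideal (MvPolynomial (Fin n) K)) (i : ℕ)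
    (S : Submodule K (MvPolynomial (Fin n) K ⧸ I))
    (hS : ∀ k, ∀ x ∈ gr I i, Ideal.Quotient.mk I (X k) * x ∈ S) : gr I (i + 1) ≤ S := by
  intro x hx
  obtain ⟨f, hf, rfl⟩ := mem_gr.1 hx
  have hmon : ∀ m ∈ f.support, Ideal.Quotient.mk I (monomial m (f.coeff m)) ∈ S := by
    intro m hm
    have hdeg : m.degree = i + 1 := by
      have := hf (mem_support_iff.1 hm)
      rw [Finsupp.degree_eq_weight_one]; exact this
    obtain ⟨k, hk⟩ : ∃ k, m k ≠ 0 := by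
      by_contra! h
      have : m = 0 := Finsupp.ext h
      simp [this] at hdeg
    have hle : Finsupp.single k 1 ≤ m := by
      rw [Finsupp.single_le_iff]; omega
    have h1 : (monomial m (f.coeff m) : MvPolynomial (Fin n) K) =
        X k * monomial (m - Finsupp.single k 1) (f.coeff m) := by
      rw [X, monomial_mul, one_mul, add_tsub_cancel_of_le hle]
    rw [h1, map_mul]
    apply hS
    refine mem_gr.2 ⟨_, isHomogeneous_monomial _ ?_, rfl⟩
    have := congrArg Finsupp.degree (add_tsub_cancel_of_le hle)
    rw [map_add, Finsupp.degree_single] at this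
    omega
  rw [f.as_sum, map_sum]
  exact Submodule.sum_mem _ hmon

theorem gr_disjoint {I : Ideal (MvPolynomial (Fin n) K)} (hI : IdealHomog I) {i k : ℕ} (hik : i ≠ k)
    {x : MvPolynomial (Fin n) K ⧸ I} (hx : x ∈ gr I i) (hy : x ∈ gr I k) : x = 0 := by
  obtain ⟨f, hf, rfl⟩ := mem_gr.1 hx
  obtain ⟨g, hg, hfg⟩ := mem_gr.1 hy
  have h1 := hI _ (Ideal.Quotient.eq.1 hfg.symm) i
  rw [map_sub, homogeneousComponent_of_mem hf, homogeneousComponent_of_mem hg, if_pos rfl,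
    if_neg (by omega), sub_zero] at h1
  exact Ideal.Quotient.eq_zero_iff_mem.2 h1

theorem mem_socle {I : Ideal (MvPolynomial (Fin n) K)} {x : MvPolynomial (Fin n) K ⧸ I} :
    x ∈ socleSub n K I ↔ ∀ k, Ideal.Quotient.mk I (X k) * x = 0 := by
  simp [socleSub]

theorem ag_top_socle {I : Ideal (MvPolynomial (Fin n) K)} {j : ℕ} (hA : IsAG n K I j) :
    gr I j ≤ socleSub n K I := by
  obtain ⟨hI, hfd, hsoc, hj, hgt⟩ := hA
  intro z hz
  rw [mem_socle]
  intro k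
  have h1 := gr_mul (X_mem_gr I k) hz
  have h2 := hgt (1 + j) (by omega)
  rw [hilb_eq_gr, Submodule.finrank_eq_zero] at h2
  rw [h2] at h1
  simpa using h1

theorem ag_exists_top {I : Ideal (MvPolynomial (Fin n) K)} {j : ℕ} (hA : IsAG n K I j) :
    ∃ z ∈ gr I j, z ≠ 0 ∧ ∀ x ∈ socleSub n K I, ∃ c : K, x = c • z := by
  have hts := ag_top_socle hA
  obtain ⟨hI, hfd, hsoc, hj, hgt⟩ := hA
  rw [hilb_eq_gr] at hj
  have : gr I j ≠ ⊥ := fun h => hj (by rw [h]; simp)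
  obtain ⟨z, hz, hz0⟩ := Submodule.exists_mem_ne_zero_of_ne_bot this
  refine ⟨z, hz, hz0, ?_⟩
  intro x hx
  obtain ⟨c, hc⟩ := (finrank_eq_one_iff_of_nonzero' (⟨z, hts hz⟩ : socleSub n K I)
    (fun h => hz0 (by simpa using h))).1 hsoc ⟨x, hx⟩
  exact ⟨c, by simpa using (congrArg Subtype.val hc).symm⟩

theorem ag_no_socle {I : Ideal (MvPolynomial (Fin n) K)} {j : ℕ} (hA : IsAG n K I j) {i : ℕ}
    (hij : i < j) {x : MvPolynomial (Fin n) K ⧸ I} (hx : x ∈ gr I i)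
    (h : ∀ k, Ideal.Quotient.mk I (X k) * x = 0) : x = 0 := by
  obtain ⟨z, hz, hz0, hall⟩ := ag_exists_top hA
  obtain ⟨c, rfl⟩ := hall x (mem_socle.2 h)
  exact gr_disjoint hA.1 (by omega) hx (Submodule.smul_mem _ _ hz)

theorem ag_pairing {I : Ideal (MvPolynomial (Fin n) K)} {j : ℕ} (hA : IsAG n K I j) :
    ∃ φ : Module.Dual K (MvPolynomial (Fin n) K ⧸ I), ∀ d i, i + d = j → ∀ x ∈ gr I i,
      (∀ y ∈ gr I d, φ (x * y) = 0) → x = 0 := by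
  obtain ⟨z, hz, hz0, hall⟩ := ag_exists_top hA
  obtain ⟨φ, hφ⟩ : ∃ f : Module.Dual K (MvPolynomial (Fin n) K ⧸ I), f z ≠ 0 := by
    by_contra! h
    exact hz0 ((Module.forall_dual_apply_eq_zero_iff K z).1 h)
  refine ⟨φ, ?_⟩
  intro d
  induction d with
  | zero =>
    intro i hi x hx h
    obtain rfl : i = j := by omega
    obtain ⟨c, rfl⟩ := hall x (ag_top_socle hA hx)
    have := h 1 (one_mem_gr I)
    simp [hφ] at this
    simp [this]
  | succ d ih =>
    intro i hi x hx h
    refine ag_no_socle hA (i := i) (by omega) hx fun k => ?_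
    refine ih (1 + i) (by omega) _ (gr_mul (X_mem_gr I k) hx) fun y hy => ?_
    have := h (Ideal.Quotient.mk I (X k) * y) (by
      rw [add_comm]; exact gr_mul (X_mem_gr I k) hy)
    rw [← this]
    congr 1
    ring

theorem finrank_range_flip' {V W : Type*} [AddCommGroup V] [Module K V] [AddCommGroup W] [Module K W]
    [FiniteDimensional K V] [FiniteDimensional K W] (β : V →ₗ[K] W →ₗ[K] K) :
    finrank K (LinearMap.range β) = finrank K (LinearMap.range β.flip) := by
  have h1 : β.flip = (LinearMap.dualMap β) ∘ₗ (Module.evalEquiv K W).toLinearMap := by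
    ext w v
    simp
  rw [h1, LinearMap.range_comp_of_range_eq_top _ (LinearEquiv.range _)]
  exact (LinearMap.finrank_range_dualMap_eq_finrank_range β).symm

theorem finrank_map_eq_range {V W : Type*} [AddCommGroup V] [Module K V] [AddCommGroup W] [Module K W]
    (P : Submodule K V) (f : V →ₗ[K] W) :
    finrank K (P.map f) = finrank K (LinearMap.range (f.domRestrict P)) := by
  rw [LinearMap.range_domRestrict]

theorem ag_rank_symm {I : Ideal (MvPolynomial (Fin n) K)} {j : ℕ} (hA : IsAG n K I j)
    {d i k : ℕ} (hd : i + k + d = j) {c : MvPolynomial (Fin n) K ⧸ I} (hc : c ∈ gr I d) :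
    finrank K ((gr I i).map (LinearMap.mulLeft K c)) =
      finrank K ((gr I k).map (LinearMap.mulLeft K c)) := by
  have hfd := hA.2.1
  obtain ⟨φ, hφ⟩ := ag_pairing hA
  let β : gr I i →ₗ[K] gr I k →ₗ[K] K :=
    LinearMap.mk₂ K (fun x y => φ (c * x * y))
      (by intros; simp [mul_add, add_mul]) (by intros; simp [q_smul_mul, q_mul_smul])
      (by intros; simp [mul_add]) (by intros; simp [q_mul_smul])
  have hβ : ∀ x y, β x y = φ (c * x * y) := fun x y => rfl
  have key : ∀ {V W : Type _} [AddCommGroup V] [Module K V] [AddCommGroup W] [Module K W]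
      (P : Submodule K V) (f : V →ₗ[K] V) (g : P →ₗ[K] W) [FiniteDimensional K P],
      (LinearMap.ker g = LinearMap.ker (f.domRestrict P)) →
      finrank K (P.map f) = finrank K (LinearMap.range g) := by
    intro V W _ _ _ _ P f g _ h
    rw [finrank_map_eq_range]
    have h1 := LinearMap.finrank_range_add_finrank_ker g
    have h2 := LinearMap.finrank_range_add_finrank_ker (f.domRestrict P)
    rw [h] at h1
    omega
  rw [key (gr I i) (LinearMap.mulLeft K c) β, key (gr I k) (LinearMap.mulLeft K c) β.flip,
    finrank_range_flip']
  · ext y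
    simp only [LinearMap.mem_ker, LinearMap.domRestrict_apply, LinearMap.mulLeft_apply]
    constructor
    · intro h
      refine hφ i (d + k) (by omega) _ (gr_mul hc y.2) fun x hx => ?_
      have := LinearMap.congr_fun h ⟨x, hx⟩
      simp only [LinearMap.flip_apply, hβ, LinearMap.zero_apply] at this
      rw [← this]; congr 1; ring
    · intro h
      ext x
      simp only [LinearMap.flip_apply, hβ, LinearMap.zero_apply]
      rw [show c * (x : MvPolynomial (Fin n) K ⧸ I) * y = (c * y) * x by ring, h]; simp
  · ext x
    simp only [LinearMap.mem_ker, LinearMap.domRestrict_apply, LinearMap.mulLeft_apply]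
    constructor
    · intro h
      refine hφ k (d + i) (by omega) _ (gr_mul hc x.2) fun y hy => ?_
      have := LinearMap.congr_fun h ⟨y, hy⟩
      simpa only [hβ, LinearMap.zero_apply] using this
    · intro h
      ext y
      simp [hβ, h]

theorem ag_hilb_symm {I : Ideal (MvPolynomial (Fin n) K)} {j : ℕ} (hA : IsAG n K I j)
    {i k : ℕ} (hd : i + k = j) : hilb n K I i = hilb n K I k := by
  have := ag_rank_symm hA (d := 0) (i := i) (k := k) (by omega) (one_mem_gr I)
  have h1 : LinearMap.mulLeft K (1 : MvPolynomial (Fin n) K ⧸ I) = LinearMap.id := by ext; simp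
  rwa [h1, Submodule.map_id, Submodule.map_id] at this

theorem finrank_map_add {V W : Type*} [AddCommGroup V] [Module K V] [AddCommGroup W] [Module K W]
    [FiniteDimensional K V]
    (P Q : Submodule K V) (f : V →ₗ[K] W) (hQ : Q ≤ P) (hk : ∀ x ∈ Q, f x = 0) :
    finrank K (P.map f) + finrank K Q ≤ finrank K P := by
  rw [finrank_map_eq_range]
  have h1 := LinearMap.finrank_range_add_finrank_ker (f.domRestrict P)
  have h2 : finrank K Q ≤ finrank K (LinearMap.ker (f.domRestrict P)) := by
    have h3 : (Q.comap P.subtype) ≤ LinearMap.ker (f.domRestrict P) := by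
      intro x hx
      simp only [LinearMap.mem_ker, LinearMap.domRestrict_apply]
      exact hk _ hx
    rw [← (Submodule.comapSubtypeEquivOfLe hQ).finrank_eq]
    exact Submodule.finrank_mono h3
  omega

theorem finrank_le_mkQ {V : Type*} [AddCommGroup V] [Module K V]
    [FiniteDimensional K V] (P T : Submodule K V) :
    finrank K P ≤ finrank K (P.map T.mkQ) + finrank K T := by
  rw [finrank_map_eq_range]
  have h1 := LinearMap.finrank_range_add_finrank_ker (T.mkQ.domRestrict P)
  have h2 : finrank K (LinearMap.ker (T.mkQ.domRestrict P)) ≤ finrank K T := by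
    refine LinearMap.finrank_le_finrank_of_injective
      (f := ((P.subtype.domRestrict _).codRestrict T ?_ :
        LinearMap.ker (T.mkQ.domRestrict P) →ₗ[K] T)) ?_
    · intro x
      have := LinearMap.mem_ker.1 x.2
      exact (Submodule.Quotient.mk_eq_zero T).1 this
    · intro x y hxy
      have := congrArg Subtype.val hxy
      simpa using this
  omega

theorem ag_pair [CharZero K] {I : Ideal (MvPolynomial (Fin 4) K)} {j : ℕ} (hA : IsAG 4 K I j)
    (hj : 2 ≤ j) (h1 : hilb 4 K I 1 = 4) (h2 : hilb 4 K I 2 ≤ 6) :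
    ∃ l ∈ gr I 1, ∃ l' ∈ gr I 1, ∀ i, 1 ≤ i → gr I (i + 1) ≤
      (gr I i).map (LinearMap.mulLeft K l) ⊔ (gr I i).map (LinearMap.mulLeft K l') := by
  have hfd := hA.2.1
  let μ : gr I 1 →ₗ[K] gr I 1 →ₗ[K] gr I 2 :=
    LinearMap.mk₂ K (fun x y => ⟨x * y, gr_mul x.2 y.2⟩)
      (by intros; ext; simp [add_mul]) (by intros; ext; simp [q_smul_mul])
      (by intros; ext; simp [mul_add]) (by intros; ext; simp [q_mul_smul])
  have hμ : ∀ x y, (μ x y : MvPolynomial (Fin 4) K ⧸ I) = x * y := fun x y => rfl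
  obtain ⟨l, l', hll⟩ := core μ (fun x y => by ext; rw [hμ, hμ, mul_comm])
    (by
      intro S hS
      rw [eq_top_iff]
      intro z _
      have h3 := gr_succ_le I 1 (S.map (gr I 2).subtype) (by
        intro k x hx
        exact ⟨_, hS ⟨_, X_mem_gr I k⟩ ⟨x, hx⟩, rfl⟩)
      obtain ⟨w, hw, hwz⟩ := h3 z.2
      have : w = z := Subtype.ext hwz
      rwa [← this]) h1 h2
    (by
      intro k hk
      ext
      refine ag_no_socle hA (i := 1) (by omega) k.2 fun m => ?_
      have := congrArg Subtype.val (hk ⟨_, X_mem_gr I m⟩)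
      rw [hμ] at this
      rw [mul_comm]; simpa using this)
  refine ⟨l, l.2, l', l'.2, ?_⟩
  intro i hi
  induction i, hi using Nat.le_induction with
  | base =>
    intro z hz
    have : (⟨z, hz⟩ : gr I 2) ∈ LinearMap.range (μ l) ⊔ LinearMap.range (μ l') := by
      rw [hll]; trivial
    obtain ⟨_, ⟨a, rfl⟩, _, ⟨b, rfl⟩, hab⟩ := Submodule.mem_sup.1 this
    have h3 := congrArg Subtype.val hab
    simp only [Submodule.coe_add, hμ] at h3
    rw [← h3]
    exact Submodule.add_mem_sup ⟨a, a.2, rfl⟩ ⟨b, b.2, rfl⟩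
  | succ i hi ih =>
    apply gr_succ_le
    intro k x hx
    obtain ⟨_, ⟨a, ha, rfl⟩, _, ⟨b, hb, rfl⟩, hab⟩ := Submodule.mem_sup.1 (ih hx)
    rw [← hab, mul_add]
    refine Submodule.add_mem_sup ⟨Ideal.Quotient.mk I (X k) * a, ?_, ?_⟩
      ⟨Ideal.Quotient.mk I (X k) * b, ?_, ?_⟩
    · rw [add_comm]; exact gr_mul (X_mem_gr I k) ha
    · simp only [LinearMap.mulLeft_apply]; ring
    · rw [add_comm]; exact gr_mul (X_mem_gr I k) hb
    · simp only [LinearMap.mulLeft_apply]; ring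

theorem ag_main [CharZero K] {I : Ideal (MvPolynomial (Fin 4) K)} {j : ℕ} (hA : IsAG 4 K I j)
    (hj : 4 ≤ j) (h1 : hilb 4 K I 1 = 4) (h2 : hilb 4 K I 2 ≤ 6) :
    (∀ m, 2 ≤ m → m ≤ j / 2 → hilb 4 K I (m - 1) ≤ hilb 4 K I m) ∧
    (∀ m, 2 ≤ m → m + 1 ≤ j / 2 →
      hilb 4 K I (m + 1) + hilb 4 K I (m - 1) ≤ 2 * hilb 4 K I m) := by
  have hfd := hA.2.1
  obtain ⟨l, hl, l', hl', hpair⟩ := ag_pair hA (by omega) h1 h2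
  set rk : ℕ → ℕ := fun i => finrank K ((gr I i).map (LinearMap.mulLeft K l)) with hrk
  have hrs : ∀ i k, i + k + 1 = j → rk i = rk k := fun i k h => ag_rank_symm hA h hl
  have hmono : ∀ i, 1 ≤ i → hilb 4 K I (i + 2) + rk i ≤ hilb 4 K I (i + 1) + rk (i + 1) := by
    intro i hi
    set T := (gr I (i + 1)).map (LinearMap.mulLeft K l) with hT
    have e1 := finrank_le_mkQ (gr I (i + 2)) T
    have e2 := finrank_map_add (gr I (i + 1)) ((gr I i).map (LinearMap.mulLeft K l))
      (T.mkQ ∘ₗ LinearMap.mulLeft K l') (by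
        rintro _ ⟨x, hx, rfl⟩
        rw [add_comm]; exact gr_mul hl hx) (by
        rintro _ ⟨x, hx, rfl⟩
        simp only [LinearMap.comp_apply, LinearMap.mulLeft_apply, Submodule.mkQ_apply,
          Submodule.Quotient.mk_eq_zero]
        refine ⟨l' * x, ?_, ?_⟩
        · rw [add_comm]; exact gr_mul hl' hx
        · simp only [LinearMap.mulLeft_apply]; ring)
    have e3 : (gr I (i + 2)).map T.mkQ ≤ (gr I (i + 1)).map (T.mkQ ∘ₗ LinearMap.mulLeft K l') := by
      rintro _ ⟨z, hz, rfl⟩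
      obtain ⟨a, ha, _, ⟨b, hb, rfl⟩, hab⟩ := Submodule.mem_sup.1 (hpair (i + 1) (by omega) hz)
      refine ⟨b, hb, ?_⟩
      rw [← hab, map_add, LinearMap.comp_apply]
      have : T.mkQ a = 0 := (Submodule.Quotient.mk_eq_zero T).2 ha
      rw [this, zero_add]
    have e4 := Submodule.finrank_mono e3
    rw [hilb_eq_gr, hilb_eq_gr]
    have e5 : rk (i + 1) = finrank K T := rfl
    have e6 : rk i = finrank K ((gr I i).map (LinearMap.mulLeft K l)) := rfl
    omega
  have hchain : ∀ d m, 2 ≤ m →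
      hilb 4 K I (m + d) + rk (m - 1) ≤ hilb 4 K I m + rk (m + d - 1) := by
    intro d
    induction d with
    | zero => intro m hm; exact le_rfl
    | succ d ih =>
      intro m hm
      have e1 := ih m hm
      have e2 := hmono (m + d - 1) (by omega)
      rw [show m + d - 1 + 2 = m + (d + 1) by omega, show m + d - 1 + 1 = m + d by omega] at e2
      rw [show m + (d + 1) - 1 = m + d by omega]
      omega
  constructor
  · intro m hm hmj
    have e1 := hchain (j + 1 - m - m) m hm
    rw [show m + (j + 1 - m - m) = j + 1 - m by omega, show j + 1 - m - 1 = j - m by omega,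
      hrs (j - m) (m - 1) (by omega), ag_hilb_symm hA (show (j + 1 - m) + (m - 1) = j by omega)] at e1
    omega
  · intro m hm hmj
    have e1 := hchain 1 m hm
    have e2 := hchain 1 (j - m) (by omega)
    rw [show j - m + 1 - 1 = j - m by omega, show j - m - 1 = j - m - 1 from rfl,
      hrs (j - m) (m - 1) (by omega), hrs (j - m - 1) m (by omega),
      ag_hilb_symm hA (show (j - m + 1) + (m - 1) = j by omega),
      ag_hilb_symm hA (show (j - m) + m = j by omega)] at e2
    rw [show m + 1 - 1 = m by omega] at e1
    omega

end agstruct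


section construct
open Module

variable {K : Type*} [Field K]

/-- sum of two coefficients -/
def phiC (m1 m2 : Fin 4 →₀ ℕ) : MvPolynomial (Fin 4) K →ₗ[K] K :=
  lcoeff K m1 + lcoeff K m2

theorem phiC_apply (m1 m2 : Fin 4 →₀ ℕ) (f : MvPolynomial (Fin 4) K) :
    phiC m1 m2 f = coeff m1 f + coeff m2 f := rfl

/-- the annihilator ideal of the functional -/
def idC (K : Type*) [Field K] (m1 m2 : Fin 4 →₀ ℕ) : Ideal (MvPolynomial (Fin 4) K) where
  carrier := {f | ∀ g, phiC m1 m2 (f * g) = 0}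
  add_mem' := by
    intro a b ha hb g
    rw [add_mul, map_add, ha g, hb g, add_zero]
  zero_mem' := by intro g; simp
  smul_mem' := by
    intro c x hx g
    rw [smul_eq_mul, mul_comm c x, mul_assoc]
    exact hx _

theorem mem_idC_def {m1 m2 : Fin 4 →₀ ℕ} {f : MvPolynomial (Fin 4) K} :
    f ∈ idC K m1 m2 ↔ ∀ g, phiC m1 m2 (f * g) = 0 := Iff.rfl

theorem phiC_mono {m1 m2 : Fin 4 →₀ ℕ} (hdis : ∀ s, s ≤ m1 → s ≤ m2 → s = 0)
    (f : MvPolynomial (Fin 4) K) {u : Fin 4 →₀ ℕ} (hu : u ≤ m1) (hne : u ≠ m1) :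
    phiC m1 m2 (f * monomial (m1 - u) 1) = coeff u f := by
  rw [phiC_apply, coeff_mul_monomial', coeff_mul_monomial', if_pos tsub_le_self,
    tsub_tsub_cancel_of_le hu, if_neg]
  · simp
  · intro h
    have := hdis _ tsub_le_self h
    exact hne (le_antisymm hu (tsub_eq_zero_iff_le.1 this))

theorem phiC_mono2 {m1 m2 : Fin 4 →₀ ℕ} (hdis : ∀ s, s ≤ m1 → s ≤ m2 → s = 0)
    (f : MvPolynomial (Fin 4) K) {u : Fin 4 →₀ ℕ} (hu : u ≤ m2) (hne : u ≠ m2) :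
    phiC m1 m2 (f * monomial (m2 - u) 1) = coeff u f := by
  rw [← phiC_mono (m1 := m2) (m2 := m1) (fun s a b => hdis s b a) f hu hne, phiC_apply, phiC_apply,
    add_comm]

theorem mem_idC {m1 m2 : Fin 4 →₀ ℕ} (hdis : ∀ s, s ≤ m1 → s ≤ m2 → s = 0)
    {f : MvPolynomial (Fin 4) K} :
    f ∈ idC K m1 m2 ↔ (∀ u, u ≤ m1 → u ≠ m1 → coeff u f = 0) ∧
      (∀ u, u ≤ m2 → u ≠ m2 → coeff u f = 0) ∧ coeff m1 f + coeff m2 f = 0 := by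
  rw [mem_idC_def]
  constructor
  · intro h
    refine ⟨fun u hu hne => ?_, fun u hu hne => ?_, ?_⟩
    · rw [← phiC_mono hdis f hu hne]; exact h _
    · rw [← phiC_mono2 hdis f hu hne]; exact h _
    · have := h 1
      rwa [mul_one] at this
  · rintro ⟨h1, h2, h3⟩ g
    induction g using MvPolynomial.induction_on' with
    | add p q hp hq => rw [mul_add, map_add, hp, hq, add_zero]
    | monomial s c =>
      rw [phiC_apply, coeff_mul_monomial', coeff_mul_monomial']
      by_cases hs : s = 0
      · subst hs
        simp [← add_mul, h3]
      · have key : ∀ m : Fin 4 →₀ ℕ, s ≤ m → m - s ≠ m := by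
          intro m hm h
          apply hs
          have := tsub_add_cancel_of_le hm
          rw [h] at this
          simpa using this
        have e1 : (if s ≤ m1 then coeff (m1 - s) f * c else 0) = 0 := by
          split_ifs with h
          · rw [h1 _ tsub_le_self (key _ h), zero_mul]
          · rfl
        have e2 : (if s ≤ m2 then coeff (m2 - s) f * c else 0) = 0 := by
          split_ifs with h
          · rw [h2 _ tsub_le_self (key _ h), zero_mul]
          · rfl
        rw [e1, e2, add_zero]

theorem finrank_map_congr {V W W' : Type*} [AddCommGroup V] [Module K V] [AddCommGroup W] [Module K W]
    [AddCommGroup W'] [Module K W'] (P : Submodule K V) (f : V →ₗ[K] W) (g : V →ₗ[K] W')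
    (h : ∀ x ∈ P, f x = 0 ↔ g x = 0) : finrank K (P.map f) = finrank K (P.map g) := by
  have h1 : LinearMap.ker (f.domRestrict P) = LinearMap.ker (g.domRestrict P) := by
    ext x
    simpa using h x.1 x.2
  rw [← LinearMap.range_domRestrict, ← LinearMap.range_domRestrict]
  rw [← (LinearMap.quotKerEquivRange (f.domRestrict P)).finrank_eq,
    ← (LinearMap.quotKerEquivRange (g.domRestrict P)).finrank_eq, h1]

theorem coeff_homog_zero {f : MvPolynomial (Fin 4) K} {i : ℕ} (hf : f.IsHomogeneous i)
    {u : Fin 4 →₀ ℕ} (hu : u.degree ≠ i) : coeff u f = 0 := by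
  by_contra h
  apply hu
  rw [Finsupp.degree_eq_weight_one]
  exact hf h

theorem deg_lt_of_lt {u m : Fin 4 →₀ ℕ} (h : u ≤ m) (hne : u ≠ m) : u.degree < m.degree := by
  have h1 := tsub_add_cancel_of_le h
  have h2 := congrArg Finsupp.degree h1
  rw [map_add] at h2
  have h3 : (m - u).degree ≠ 0 := by
    intro h4
    rw [Finsupp.degree_eq_zero_iff] at h4
    rw [h4, zero_add] at h1
    exact hne h1
  omega

theorem idC_mk_eq_zero {m1 m2 : Fin 4 →₀ ℕ} (f : MvPolynomial (Fin 4) K) :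
    (Ideal.Quotient.mkₐ K (idC K m1 m2)).toLinearMap f = 0 ↔ f ∈ idC K m1 m2 :=
  Ideal.Quotient.eq_zero_iff_mem

theorem hilb_idC_lt {m1 m2 : Fin 4 →₀ ℕ} (hdis : ∀ s, s ≤ m1 → s ≤ m2 → s = 0) {j : ℕ}
    (hm1 : m1.degree = j) (hm2 : m2.degree = j) {i : ℕ} (hi : i < j) (S : Finset (Fin 4 →₀ ℕ))
    (hS : ∀ u, u ∈ S ↔ (u ≤ m1 ∨ u ≤ m2) ∧ u.degree = i) :
    hilb 4 K (idC K m1 m2) i = S.card := by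
  let T : MvPolynomial (Fin 4) K →ₗ[K] (S → K) := LinearMap.pi fun u => lcoeff K u.1
  have hT : ∀ f u, T f u = coeff u.1 f := fun f u => rfl
  rw [hilb, finrank_map_congr _ _ T]
  · have : (homogeneousSubmodule (Fin 4) K i).map T = ⊤ := by
      rw [eq_top_iff]
      intro g _
      refine ⟨∑ u : S, monomial u.1 (g u), ?_, ?_⟩
      · apply Submodule.sum_mem
        intro u _
        exact isHomogeneous_monomial _ ((hS u.1).1 u.2).2
      · ext v
        rw [hT, coeff_sum]
        simp only [coeff_monomial]
        rw [Finset.sum_eq_single v]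
        · simp
        · intro b _ hb
          rw [if_neg]
          exact fun h => hb (Subtype.ext h)
        · simp
    rw [this, finrank_top, finrank_fintype_fun_eq_card, Fintype.card_coe]
  · intro f hf
    rw [mem_homogeneousSubmodule] at hf
    rw [idC_mk_eq_zero, mem_idC hdis]
    constructor
    · rintro ⟨h1, h2, h3⟩
      ext u
      rw [hT]
      obtain ⟨h4 | h4, h5⟩ := (hS u.1).1 u.2
      · exact h1 _ h4 (fun h => by rw [h] at h5; omega)
      · exact h2 _ h4 (fun h => by rw [h] at h5; omega)
    · intro h
      have key : ∀ u, (u ≤ m1 ∨ u ≤ m2) → coeff u f = 0 := by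
        intro u hu
        by_cases hd : u.degree = i
        · exact congrFun h ⟨u, (hS u).2 ⟨hu, hd⟩⟩
        · exact coeff_homog_zero hf hd
      exact ⟨fun u hu _ => key u (Or.inl hu), fun u hu _ => key u (Or.inr hu),
        by rw [key m1 (Or.inl le_rfl), key m2 (Or.inr le_rfl), add_zero]⟩

theorem hilb_idC_top {m1 m2 : Fin 4 →₀ ℕ} (hdis : ∀ s, s ≤ m1 → s ≤ m2 → s = 0) {j : ℕ}
    (hm1 : m1.degree = j) (hm2 : m2.degree = j) (hne : m1 ≠ m2) :
    hilb 4 K (idC K m1 m2) j = 1 := by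
  rw [hilb, finrank_map_congr _ _ (phiC m1 m2)]
  · have : (homogeneousSubmodule (Fin 4) K j).map (phiC (K := K) m1 m2) = ⊤ := by
      rw [eq_top_iff]
      intro g _
      refine ⟨monomial m1 g, isHomogeneous_monomial _ hm1, ?_⟩
      simp [phiC_apply, coeff_monomial, hne]
    rw [this, finrank_top, finrank_self]
  · intro f hf
    rw [mem_homogeneousSubmodule] at hf
    rw [idC_mk_eq_zero, mem_idC hdis, phiC_apply]
    constructor
    · exact fun h => h.2.2
    · intro h
      refine ⟨fun u hu hn => coeff_homog_zero hf ?_, fun u hu hn => coeff_homog_zero hf ?_, h⟩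
      · have := deg_lt_of_lt hu hn; omega
      · have := deg_lt_of_lt hu hn; omega

theorem hilb_idC_gt {m1 m2 : Fin 4 →₀ ℕ} (hdis : ∀ s, s ≤ m1 → s ≤ m2 → s = 0) {j : ℕ}
    (hm1 : m1.degree = j) (hm2 : m2.degree = j) {i : ℕ} (hi : j < i) :
    hilb 4 K (idC K m1 m2) i = 0 := by
  rw [hilb, finrank_map_congr _ _ (0 : MvPolynomial (Fin 4) K →ₗ[K] K)]
  · simp
  · intro f hf
    rw [mem_homogeneousSubmodule] at hf
    rw [idC_mk_eq_zero, mem_idC hdis]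
    have key : ∀ m : Fin 4 →₀ ℕ, m.degree = j → ∀ u, u ≤ m → coeff u f = 0 := by
      intro m hm u hu
      apply coeff_homog_zero hf
      have : u.degree ≤ m.degree := by
        by_cases h : u = m
        · rw [h]
        · exact (deg_lt_of_lt hu h).le
      omega
    simp only [LinearMap.zero_apply, iff_true]
    exact ⟨fun u hu _ => key m1 hm1 u hu, fun u hu _ => key m2 hm2 u hu,
      by rw [key m1 hm1 m1 le_rfl, key m2 hm2 m2 le_rfl, add_zero]⟩

theorem idC_homog {m1 m2 : Fin 4 →₀ ℕ} (hdis : ∀ s, s ≤ m1 → s ≤ m2 → s = 0)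
    (hm : m1.degree = m2.degree) : IdealHomog (idC K m1 m2) := by
  intro f hf d
  rw [mem_idC hdis] at hf ⊢
  obtain ⟨h1, h2, h3⟩ := hf
  simp only [coeff_homogeneousComponent]
  refine ⟨fun u hu hn => ?_, fun u hu hn => ?_, ?_⟩
  · rw [h1 u hu hn, ite_self]
  · rw [h2 u hu hn, ite_self]
  · rw [hm]
    split_ifs
    · exact h3
    · simp

theorem idC_finite {m1 m2 : Fin 4 →₀ ℕ} (hdis : ∀ s, s ≤ m1 → s ≤ m2 → s = 0) :
    FiniteDimensional K (MvPolynomial (Fin 4) K ⧸ idC K m1 m2) := by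
  let F : Set (Fin 4 →₀ ℕ) := Set.Icc 0 m1 ∪ Set.Icc 0 m2
  have hF : F.Finite := (Set.finite_Icc _ _).union (Set.finite_Icc _ _)
  let P : Submodule K (MvPolynomial (Fin 4) K ⧸ idC K m1 m2) :=
    Submodule.span K ((fun u => Ideal.Quotient.mkₐ K (idC K m1 m2) (monomial u 1)) '' F)
  have hP : P = ⊤ := by
    rw [eq_top_iff]
    intro x _
    obtain ⟨f, rfl⟩ := Ideal.Quotient.mkₐ_surjective K (idC K m1 m2) x
    induction f using MvPolynomial.induction_on' with
    | add p q hp hq => rw [map_add]; exact add_mem (hp trivial) (hq trivial)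
    | monomial u c =>
      by_cases hu : u ∈ F
      · have : (monomial u c : MvPolynomial (Fin 4) K) = c • monomial u 1 := by
          rw [smul_monomial]; simp
        rw [this, map_smul]
        exact Submodule.smul_mem _ _ (Submodule.subset_span ⟨u, hu, rfl⟩)
      · have h0 : Ideal.Quotient.mkₐ K (idC K m1 m2) (monomial u c) = 0 := by
          apply Ideal.Quotient.eq_zero_iff_mem.2
          rw [mem_idC hdis]
          have key : ∀ v, v ∈ F → coeff v (monomial u c : MvPolynomial (Fin 4) K) = 0 := by
            intro v hv
            rw [coeff_monomial, if_neg]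
            rintro rfl
            exact hu hv
          refine ⟨fun v hv _ => key v (Or.inl ⟨zero_le, hv⟩),
            fun v hv _ => key v (Or.inr ⟨zero_le, hv⟩), ?_⟩
          rw [key m1 (Or.inl ⟨zero_le, le_rfl⟩), key m2 (Or.inr ⟨zero_le, le_rfl⟩), add_zero]
        rw [h0]
        exact zero_mem _
  refine ⟨?_⟩
  rw [← hP]
  exact Submodule.fg_span (hF.image _)

theorem idC_socle {m1 m2 : Fin 4 →₀ ℕ} (hdis : ∀ s, s ≤ m1 → s ≤ m2 → s = 0)
    (hm1 : m1 ≠ 0) (hne : m1 ≠ m2) :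
    finrank K (socleSub 4 K (idC K m1 m2)) = 1 := by
  have hsoc : ∀ x : MvPolynomial (Fin 4) K ⧸ idC K m1 m2, x ∈ socleSub 4 K (idC K m1 m2) ↔
      ∀ k, Ideal.Quotient.mk (idC K m1 m2) (X k) * x = 0 := by
    intro x; simp [socleSub]
  have hv : Ideal.Quotient.mk (idC K m1 m2) (monomial m1 1) ∈ socleSub 4 K (idC K m1 m2) := by
    rw [hsoc]
    intro k
    rw [← map_mul, Ideal.Quotient.eq_zero_iff_mem, X, monomial_mul, mem_idC hdis]
    have key : ∀ u, (u ≤ m1 ∨ u ≤ m2) →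
        coeff u (monomial (Finsupp.single k 1 + m1) (1 * 1) : MvPolynomial (Fin 4) K) = 0 := by
      intro u hu
      rw [coeff_monomial, if_neg]
      rintro rfl
      rcases hu with hu | hu
      · have := hu k
        simp at this
      · exact hm1 (hdis m1 le_rfl (le_trans le_add_self hu))
    exact ⟨fun u hu _ => key u (Or.inl hu), fun u hu _ => key u (Or.inr hu),
        by rw [key m1 (Or.inl le_rfl), key m2 (Or.inr le_rfl), add_zero]⟩
  have hv0 : Ideal.Quotient.mk (idC K m1 m2) (monomial m1 1) ≠ 0 := by
    intro h
    rw [Ideal.Quotient.eq_zero_iff_mem, mem_idC hdis] at h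
    have := h.2.2
    simp [coeff_monomial, hne] at this
  rw [finrank_eq_one_iff_of_nonzero' (⟨_, hv⟩ : socleSub 4 K (idC K m1 m2))
    (fun h => hv0 (by simpa using h))]
  rintro ⟨w, hw⟩
  obtain ⟨f, rfl⟩ := Ideal.Quotient.mk_surjective w
  rw [hsoc] at hw
  refine ⟨phiC m1 m2 f, Subtype.ext ?_⟩
  have hkill : ∀ s : Fin 4 →₀ ℕ, s ≠ 0 → phiC m1 m2 (f * monomial s 1) = 0 := by
    intro s hs
    obtain ⟨k, hk⟩ : ∃ k, s k ≠ 0 := by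
      by_contra! h
      exact hs (Finsupp.ext h)
    have hle : Finsupp.single k 1 ≤ s := by
      rw [Finsupp.single_le_iff]; omega
    have h1 := hw k
    rw [← map_mul, Ideal.Quotient.eq_zero_iff_mem, mem_idC_def] at h1
    have h2 := h1 (monomial (s - Finsupp.single k 1) 1)
    rw [mul_comm (X k) f, mul_assoc, X, monomial_mul, one_mul, add_tsub_cancel_of_le hle] at h2
    exact h2
  have hmul : (phiC m1 m2 f) • Ideal.Quotient.mk (idC K m1 m2) (monomial m1 1) =
      Ideal.Quotient.mk (idC K m1 m2) (monomial m1 (phiC m1 m2 f)) := by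
    have : (monomial m1 (phiC m1 m2 f) : MvPolynomial (Fin 4) K) =
        (phiC m1 m2 f) • monomial m1 1 := by
      rw [smul_monomial]; simp
    rw [this]
    exact (map_smul (Ideal.Quotient.mkₐ K (idC K m1 m2)) _ _).symm
  change (phiC m1 m2 f) • Ideal.Quotient.mk (idC K m1 m2) (monomial m1 1) = _
  rw [hmul, Ideal.Quotient.eq, mem_idC hdis]
  have hsub : ∀ m u : Fin 4 →₀ ℕ, u ≤ m → u ≠ m → m - u ≠ 0 := fun m u hu hn h =>
    hn (le_antisymm hu (tsub_eq_zero_iff_le.1 h))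
  refine ⟨fun u hu hn => ?_, fun u hu hn => ?_, ?_⟩
  · rw [coeff_sub, coeff_monomial, if_neg (Ne.symm hn), ← phiC_mono hdis f hu hn,
      hkill _ (hsub _ _ hu hn), sub_zero]
  · rw [coeff_sub, coeff_monomial, if_neg, ← phiC_mono2 hdis f hu hn,
      hkill _ (hsub _ _ hu hn), sub_zero]
    rintro rfl
    exact hm1 (hdis _ le_rfl hu)
  · rw [coeff_sub, coeff_sub, coeff_monomial, coeff_monomial, if_pos rfl, if_neg hne, phiC_apply]
    ring

theorem idC_isAG {m1 m2 : Fin 4 →₀ ℕ} (hdis : ∀ s, s ≤ m1 → s ≤ m2 → s = 0) {j : ℕ}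
    (hm1 : m1.degree = j) (hm2 : m2.degree = j) (hj : j ≠ 0) : IsAG 4 K (idC K m1 m2) j := by
  have h0 : m1 ≠ 0 := by
    rintro rfl
    simp at hm1; omega
  have hne : m1 ≠ m2 := by
    rintro rfl
    exact h0 (hdis _ le_rfl le_rfl)
  refine ⟨idC_homog hdis (hm1.trans hm2.symm), idC_finite hdis, idC_socle hdis h0 hne, ?_, ?_⟩
  · rw [hilb_idC_top hdis hm1 hm2 hne]; exact one_ne_zero
  · intro i hi
    exact hilb_idC_gt hdis hm1 hm2 hi

/-- the exponent with given entries -/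
def exC (a b c d : ℕ) : Fin 4 →₀ ℕ := Finsupp.equivFunOnFinite.symm ![a, b, c, d]

theorem le_exC (u : Fin 4 →₀ ℕ) (a b c d : ℕ) :
    u ≤ exC a b c d ↔ u 0 ≤ a ∧ u 1 ≤ b ∧ u 2 ≤ c ∧ u 3 ≤ d := by
  rw [Finsupp.le_def]
  simp [Fin.forall_fin_succ, exC]

theorem degree_four (u : Fin 4 →₀ ℕ) : u.degree = u 0 + u 1 + u 2 + u 3 := by
  rw [Finsupp.degree_eq_sum, Fin.sum_univ_four]

theorem ext_four {u v : Fin 4 →₀ ℕ} (h0 : u 0 = v 0) (h1 : u 1 = v 1) (h2 : u 2 = v 2)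
    (h3 : u 3 = v 3) : u = v := by
  ext i
  fin_cases i <;> assumption

theorem exC_vals (a b c d : ℕ) : exC a b c d 0 = a ∧ exC a b c d 1 = b ∧ exC a b c d 2 = c ∧
    exC a b c d 3 = d := by
  simp [exC]

theorem construct_exists (K : Type*) [Field K] {j q q' : ℕ} (hj : 0 < j) (hq : q ≤ j / 2)
    (hq' : q' ≤ j / 2) :
    ∃ I : Ideal (MvPolynomial (Fin 4) K), IsAG 4 K I j ∧ hilb 4 K I j = 1 ∧
      ∀ i, 1 ≤ i → i ≤ j / 2 → hilb 4 K I i = min q i + min q' i + 2 := by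
  have hdis : ∀ s : Fin 4 →₀ ℕ, s ≤ exC (j - q) q 0 0 → s ≤ exC 0 0 (j - q') q' → s = 0 := by
    intro s h1 h2
    rw [le_exC] at h1 h2
    apply ext_four <;> simp <;> omega
  have hd1 : (exC (j - q) q 0 0).degree = j := by
    rw [degree_four]
    obtain ⟨h0, h1, h2, h3⟩ := exC_vals (j - q) q 0 0
    omega
  have hd2 : (exC 0 0 (j - q') q').degree = j := by
    rw [degree_four]
    obtain ⟨h0, h1, h2, h3⟩ := exC_vals 0 0 (j - q') q'
    omega
  refine ⟨idC K (exC (j - q) q 0 0) (exC 0 0 (j - q') q'), idC_isAG hdis hd1 hd2 (by omega), ?_, ?_⟩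
  · refine hilb_idC_top hdis hd1 hd2 ?_
    intro h
    have h1 := hdis _ le_rfl h.le
    rw [h1] at hd1
    simp at hd1
    omega
  · intro i hi1 hi2
    classical
    let S1 : Finset (Fin 4 →₀ ℕ) := (Finset.range (min q i + 1)).image fun b => exC (i - b) b 0 0
    let S2 : Finset (Fin 4 →₀ ℕ) := (Finset.range (min q' i + 1)).image fun b => exC 0 0 (i - b) b
    have hc1 : S1.card = min q i + 1 := by
      rw [Finset.card_image_of_injective, Finset.card_range]
      intro b b' h
      have := congrArg (fun u : Fin 4 →₀ ℕ => u 1) h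
      simpa [exC] using this
    have hc2 : S2.card = min q' i + 1 := by
      rw [Finset.card_image_of_injective, Finset.card_range]
      intro b b' h
      have := congrArg (fun u : Fin 4 →₀ ℕ => u 3) h
      simpa [exC] using this
    have hmem1 : ∀ u, u ∈ S1 ↔ u ≤ exC (j - q) q 0 0 ∧ u.degree = i := by
      intro u
      rw [le_exC, degree_four, Finset.mem_image]
      constructor
      · rintro ⟨b, hb, rfl⟩
        rw [Finset.mem_range] at hb
        obtain ⟨h0, h1, h2, h3⟩ := exC_vals (i - b) b 0 0
        rw [h0, h1, h2, h3]
        omega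
      · intro h
        refine ⟨u 1, ?_, ?_⟩
        · rw [Finset.mem_range]; omega
        · obtain ⟨h0, h1, h2, h3⟩ := exC_vals (i - u 1) (u 1) 0 0
          apply ext_four <;> omega
    have hmem2 : ∀ u, u ∈ S2 ↔ u ≤ exC 0 0 (j - q') q' ∧ u.degree = i := by
      intro u
      rw [le_exC, degree_four, Finset.mem_image]
      constructor
      · rintro ⟨b, hb, rfl⟩
        rw [Finset.mem_range] at hb
        obtain ⟨h0, h1, h2, h3⟩ := exC_vals 0 0 (i - b) b
        rw [h0, h1, h2, h3]
        omega
      · intro h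
        refine ⟨u 3, ?_, ?_⟩
        · rw [Finset.mem_range]; omega
        · obtain ⟨h0, h1, h2, h3⟩ := exC_vals 0 0 (i - u 3) (u 3)
          apply ext_four <;> omega
    have hdisj : Disjoint S1 S2 := by
      rw [Finset.disjoint_left]
      intro u h1 h2
      rw [hmem1] at h1
      rw [hmem2] at h2
      have := hdis u h1.1 h2.1
      rw [this] at h1
      simp at h1
      omega
    rw [hilb_idC_lt hdis hd1 hd2 (i := i) (by omega) (S1 ∪ S2), Finset.card_union_of_disjoint hdisj,
      hc1, hc2]
    · ring
    · intro u
      rw [Finset.mem_union, hmem1, hmem2]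
      tauto

theorem macB_zero (d : ℕ) : macB 0 d = 0 := by
  cases d <;> simp [macB]

theorem macB_one (d : ℕ) : macB 1 (d + 1) = 1 := by
  have hk : Nat.findGreatest (fun k => Nat.choose k (d + 1) ≤ 1) (1 + d + 1) = d + 1 := by
    rw [Nat.findGreatest_eq_iff]
    refine ⟨by omega, fun _ => by simp, ?_⟩
    intro n hn hn2
    obtain rfl : n = d + 2 := by omega
    rw [show d + 2 = (d + 1) + 1 by rfl, Nat.choose_succ_self_right]
    omega
  rw [macB, if_neg one_ne_zero]
  simp only [hk]
  simp [macB_zero]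

theorem macB_two (d : ℕ) : macB 2 (d + 2) = 2 := by
  have hk : Nat.findGreatest (fun k => Nat.choose k (d + 1 + 1) ≤ 2) (2 + (d + 1) + 1) = d + 2 := by
    rw [Nat.findGreatest_eq_iff]
    refine ⟨by omega, fun _ => by simp, ?_⟩
    intro n hn hn2 h
    have h1 : Nat.choose (d + 3) (d + 2) ≤ Nat.choose n (d + 2) := Nat.choose_le_choose _ (by omega)
    rw [show d + 3 = (d + 2) + 1 by rfl, Nat.choose_succ_self_right] at h1
    have h2 : Nat.choose n (d + 2) ≤ 2 := h
    omega
  rw [macB, if_neg two_ne_zero]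
  simp only [hk]
  simp [macB_one]

theorem macB_small (c i : ℕ) (hc : c ≤ 2) (hi : 2 ≤ i) : macB c i = c := by
  obtain ⟨d, rfl⟩ : ∃ d, i = d + 2 := ⟨i - 2, by omega⟩
  interval_cases c
  · exact macB_zero _
  · exact macB_one _
  · exact macB_two _

theorem macB_three_one : 2 ≤ macB 3 1 := by
  have : macB 3 1 = 6 := by rfl
  omega

theorem deltaO_iff (h : ℕ → ℕ) (m : ℕ) (hm : 2 ≤ m) (h0 : h 0 = 1) (h1 : h 1 = 4) (h2 : h 2 ≤ 6) :
    DeltaOSeq h m ↔ (∀ i, 2 ≤ i → i ≤ m → h (i - 1) ≤ h i) ∧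
      (∀ i, 2 ≤ i → i + 1 ≤ m → h (i + 1) + h (i - 1) ≤ 2 * h i) := by
  have aux : ∀ (f : ∀ i, 2 ≤ i → i ≤ m → h (i - 1) ≤ h i), (∀ i, 2 ≤ i → i + 1 ≤ m →
      h i - h (i - 1) ≤ 2 → h (i + 1) - h i ≤ h i - h (i - 1)) →
      ∀ i, 2 ≤ i → i ≤ m → h i - h (i - 1) ≤ 2 := by
    intro f g i hi
    induction i, hi using Nat.le_induction with
    | base => intro _; norm_num; omega
    | succ i hi ih =>
      intro him
      have e1 := ih (by omega)
      have e2 := g i hi him e1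
      rw [Nat.add_sub_cancel]
      omega
  constructor
  · rintro ⟨ha, -, hb⟩
    have hb' : ∀ i, 2 ≤ i → i + 1 ≤ m →
      h i - h (i - 1) ≤ 2 → h (i + 1) - h i ≤ h i - h (i - 1) := by
      intro i hi him hle
      have e := hb i (by omega) him
      simp only [Nat.add_eq_zero_iff, one_ne_zero, and_false, if_false, Nat.add_sub_cancel,
        show i ≠ 0 by omega] at e
      rwa [macB_small _ _ hle hi] at e
    have ha' : ∀ i, 2 ≤ i → i ≤ m → h (i - 1) ≤ h i := fun i hi him => ha i (by omega) him
    refine ⟨ha', fun i hi him => ?_⟩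
    have e1 := aux ha' hb' i hi (by omega)
    have e2 := hb' i hi him e1
    have e3 := ha' i hi (by omega)
    have e4 := ha' (i + 1) (by omega) him
    rw [Nat.add_sub_cancel] at e4
    omega
  · rintro ⟨ha, hb⟩
    refine ⟨fun i hi him => ?_, by simp, fun i hi him => ?_⟩
    · rcases Nat.lt_or_ge i 2 with hlt | hge
      · obtain rfl : i = 1 := by omega
        simp [h0, h1]
      · exact ha i hge him
    · simp only [Nat.add_eq_zero_iff, one_ne_zero, and_false, if_false, Nat.add_sub_cancel,
        show i ≠ 0 by omega]
      rcases Nat.lt_or_ge i 2 with hlt | hge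
      · obtain rfl : i = 1 := by omega
        rw [Nat.sub_self, h0, h1]
        have := macB_three_one
        norm_num
        omega
      · have hc : ∀ i, 2 ≤ i → i + 1 ≤ m →
          h i - h (i - 1) ≤ 2 → h (i + 1) - h i ≤ h i - h (i - 1) := by
          intro i hi him _
          have e1 := hb i hi him
          have e2 := ha i hi (by omega)
          omega
        have e1 := aux ha hc i hge (by omega)
        rw [macB_small _ _ e1 hge]
        exact hc i hge him e1

theorem exists_shape (h : ℕ → ℕ) (m : ℕ) (h1 : h 1 = 4) (h2 : h 2 ≤ 6)
    (ha : ∀ i, 2 ≤ i → i ≤ m → h (i - 1) ≤ h i)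
    (hb : ∀ i, 2 ≤ i → i + 1 ≤ m → h (i + 1) + h (i - 1) ≤ 2 * h i) :
    ∀ M, 1 ≤ M → M ≤ m → ∃ q q', 1 ≤ q' ∧ q' ≤ q ∧ q ≤ M ∧
      ∀ i, 1 ≤ i → i ≤ M → h i = min q i + min q' i + 2 := by
  intro M hM
  induction M, hM using Nat.le_induction with
  | base =>
    intro _
    refine ⟨1, 1, le_rfl, le_rfl, le_rfl, fun i hi hi2 => ?_⟩
    obtain rfl : i = 1 := by omega
    simp [h1]
  | succ M hM ih =>
    intro hm
    obtain ⟨q, q', hq1, hq2, hq3, hall⟩ := ih (by omega)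
    have e0 := hall M hM le_rfl
    have e1 := ha (M + 1) (by omega) hm
    rw [Nat.add_sub_cancel] at e1
    have e2 : h (M + 1) ≤ h M + (if q = M then 1 else 0) + (if q' = M then 1 else 0) := by
      rcases Nat.lt_or_ge M 2 with hlt | hge
      · obtain rfl : M = 1 := by omega
        rw [if_pos (by omega), if_pos (by omega), h1]
        exact h2
      · have e3 := hb M hge hm
        have e4 := hall (M - 1) (by omega) (by omega)
        split_ifs <;> omega
    by_cases hc2 : h (M + 1) = h M + 2
    · have : q = M ∧ q' = M := by split_ifs at e2 <;> omega
      refine ⟨M + 1, M + 1, by omega, le_rfl, le_rfl, fun i hi hi2 => ?_⟩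
      rcases Nat.lt_or_ge i (M + 1) with hlt | hge
      · have := hall i hi (by omega); omega
      · obtain rfl : i = M + 1 := by omega
        omega
    by_cases hc1 : h (M + 1) = h M + 1
    · have : q = M := by split_ifs at e2 <;> omega
      refine ⟨M + 1, q', by omega, by omega, le_rfl, fun i hi hi2 => ?_⟩
      rcases Nat.lt_or_ge i (M + 1) with hlt | hge
      · have := hall i hi (by omega); omega
      · obtain rfl : i = M + 1 := by omega
        omega
    · have : h (M + 1) = h M := by split_ifs at e2 <;> omega
      refine ⟨q, q', by omega, by omega, by omega, fun i hi hi2 => ?_⟩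
      rcases Nat.lt_or_ge i (M + 1) with hlt | hge
      · have := hall i hi (by omega); omega
      · obtain rfl : i = M + 1 := by omega
        omega

end construct

/-- Let `j ≥ 4` and let `H = (h_0,...,h_j)` be a symmetric
sequence of positive integers with `h_0 = 1`, `h_1 = 4`, `h_2 = a ≤ 6`.  Then
`H` is a Gorenstein sequence (the Hilbert function of a graded Artinian
Gorenstein quotient of `K[w,x,y,z]`) iff `ΔH_{≤ j/2}` is an O-sequence.
Moreover, no Gorenstein sequence of socle degree `j' ≥ 4` has `h_1 = 4` and
`h_2 ∈ {2,3}`. -/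
theorem statement_18 {K : Type*} [Field K] [IsAlgClosed K] [CharZero K]
    (j : ℕ) (hj : 4 ≤ j) (a : ℕ) (ha : a ≤ 6) (h : ℕ → ℕ)
    (hpos : ∀ i ≤ j, 0 < h i) (hsym : ∀ i ≤ j, h (j - i) = h i)
    (h0 : h 0 = 1) (h1 : h 1 = 4) (h2 : h 2 = a) :
    ((∃ I : Ideal (MvPolynomial (Fin 4) K), IsAG 4 K I j ∧
        ∀ i ≤ j, hilb 4 K I i = h i) ↔
      DeltaOSeq h (j / 2)) ∧
    (∀ j' : ℕ, 4 ≤ j' → ∀ I : Ideal (MvPolynomial (Fin 4) K), IsAG 4 K I j' →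
      hilb 4 K I 1 = 4 → hilb 4 K I 2 ≠ 2 ∧ hilb 4 K I 2 ≠ 3) := by
  constructor
  · constructor
    · rintro ⟨I, hA, hh⟩
      have e1 : hilb 4 K I 1 = 4 := by rw [hh 1 (by omega), h1]
      have e2 : hilb 4 K I 2 ≤ 6 := by rw [hh 2 (by omega), h2]; exact ha
      obtain ⟨p1, p2⟩ := ag_main hA hj e1 e2
      refine (deltaO_iff h (j / 2) (by omega) h0 h1 (by omega)).2 ⟨?_, ?_⟩
      · intro i hi hi'
        have := p1 i hi hi'
        rwa [hh i (by omega), hh (i - 1) (by omega)] at this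
      · intro i hi hi'
        have := p2 i hi hi'
        rwa [hh i (by omega), hh (i - 1) (by omega), hh (i + 1) (by omega)] at this
    · intro hD
      obtain ⟨p1, p2⟩ := (deltaO_iff h (j / 2) (by omega) h0 h1 (by omega)).1 hD
      obtain ⟨q, q', hq1, hq2, hq3, hq⟩ :=
        exists_shape h (j / 2) h1 (by omega) p1 p2 (j / 2) (by omega) le_rfl
      obtain ⟨I, hA, hIj, hI⟩ :=
        construct_exists K (j := j) (q := q) (q' := q') (by omega) (by omega) (by omega)
      refine ⟨I, hA, ?_⟩
      have hlow : ∀ i, i ≤ j / 2 → hilb 4 K I i = h i := by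
        intro i hi
        rcases Nat.eq_zero_or_pos i with rfl | hp
        · rw [ag_hilb_symm hA (i := 0) (k := j) (by omega), hIj, h0]
        · rw [hI i hp hi, hq i hp hi]
      intro i hi
      by_cases hc : i ≤ j / 2
      · exact hlow i hc
      · rw [ag_hilb_symm hA (i := i) (k := j - i) (by omega), hlow (j - i) (by omega), hsym i hi]
  · intro j' hj' I hA e1
    by_contra hc
    have e2 : hilb 4 K I 2 ≤ 3 := by
      by_contra h3
      exact hc ⟨by omega, by omega⟩
    have := (ag_main hA hj' e1 (by omega)).1 2 le_rfl (by omega)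
    norm_num at this
    omega

end
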